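/- For the real Bohnenblust–Hille constants C, the sequence n ↦ (C_{2n+1}/C_{2n}) / (C_{n+1}/C_n)^((n+1)/(2n+1)) (n ranging over positive integers) converges to 1 as n → ∞. -/

import Mathlib

open Real Filter

/-- The Khinchine-inequality constant `A_p = √2 · (Γ((p+1)/2)/√π)^(1/p)`. -/
noncomputable def khinchineA (p : ℝ) : ℝ :=
  Real.sqrt 2 * (Real.Gamma ((p + 1) / 2) / Real.sqrt π) ^ (1 / p)

/-- The real Bohnenblust–Hille constants: `C 1 = 1`, `C 2 = √2`, `C 3 = 2^(5/6)`,
`C m = C (m/2) / A_{2m/(m+2)}^(m/2)` for even `m ≥ 4`, and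
`C m = (C ((m−1)/2) / A_{(2m−2)/(m+1)}^((m+1)/2))^((m−1)/(2m)) ·
       (C ((m+1)/2) / A_{(2m+2)/(m+3)}^((m−1)/2))^((m+1)/(2m))` for odd `m ≥ 5`. -/
noncomputable def bhConstR : ℕ → ℝ
  | m =>
    if _h1 : m ≤ 1 then 1
    else if _h2 : m = 2 then Real.sqrt 2
    else if _h3 : m = 3 then (2 : ℝ) ^ ((5 : ℝ) / 6)
    else if _h4 : m % 2 = 0 then
      bhConstR (m / 2) / khinchineA (2 * (m : ℝ) / ((m : ℝ) + 2)) ^ ((m : ℝ) / 2)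
    else
      (bhConstR ((m - 1) / 2) /
          khinchineA ((2 * (m : ℝ) - 2) / ((m : ℝ) + 1)) ^ (((m : ℝ) + 1) / 2)) ^
        (((m : ℝ) - 1) / (2 * (m : ℝ))) *
      (bhConstR ((m + 1) / 2) /
          khinchineA ((2 * (m : ℝ) + 2) / ((m : ℝ) + 3)) ^ (((m : ℝ) - 1) / 2)) ^
        (((m : ℝ) + 1) / (2 * (m : ℝ)))
  termination_by m => m
  decreasing_by all_goals omega

lemma khA_pos {p : ℝ} (hp : 0 < p) : 0 < khinchineA p := by
  unfold khinchineA
  have h1 : 0 < Real.Gamma ((p + 1) / 2) := Real.Gamma_pos_of_pos (by linarith)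
  have h2 : 0 < Real.sqrt π := Real.sqrt_pos.2 Real.pi_pos
  positivity

lemma bh_pos (m : ℕ) : 0 < bhConstR m := by
  induction m using Nat.strong_induction_on with
  | _ m ih =>
    rw [bhConstR]
    split_ifs with h1 h2 h3 h4
    · norm_num
    · positivity
    · positivity
    · have := ih (m / 2) (by omega)
      have hm : (2 : ℝ) ≤ m := by exact_mod_cast (by omega : 2 ≤ m)
      have := khA_pos (p := 2 * (m : ℝ) / ((m : ℝ) + 2)) (by positivity)
      positivity
    · have := ih ((m - 1) / 2) (by omega)
      have := ih ((m + 1) / 2) (by omega)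
      have hm : (2 : ℝ) ≤ m := by exact_mod_cast (by omega : 2 ≤ m)
      have := khA_pos (p := (2 * (m : ℝ) - 2) / ((m : ℝ) + 1))
        (div_pos (by linarith) (by linarith))
      have := khA_pos (p := (2 * (m : ℝ) + 2) / ((m : ℝ) + 3)) (by positivity)
      positivity

noncomputable def bhP (n : ℕ) : ℝ := 2 * (n : ℝ) / ((n : ℝ) + 1)

noncomputable def bhB (n : ℕ) : ℝ := n * Real.log (khinchineA (bhP n))

lemma bh_even (n : ℕ) (hn : 2 ≤ n) :
    bhConstR (2 * n) = bhConstR n / khinchineA (bhP n) ^ (n : ℝ) := by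
  rw [bhConstR]
  rw [dif_neg (by omega), dif_neg (by omega), dif_neg (by omega), dif_pos (by omega)]
  have e : 2 * n / 2 = n := by omega
  have e2 : 2 * ((2 * n : ℕ) : ℝ) / (((2 * n : ℕ) : ℝ) + 2) = bhP n := by
    unfold bhP; push_cast; field_simp
  have e3 : ((2 * n : ℕ) : ℝ) / 2 = n := by push_cast; ring
  rw [e, e2, e3]

lemma bh_odd (n : ℕ) (hn : 2 ≤ n) :
    bhConstR (2 * n + 1) =
      (bhConstR n / khinchineA (bhP n) ^ ((n : ℝ) + 1)) ^ ((n : ℝ) / (2 * n + 1)) *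
      (bhConstR (n + 1) / khinchineA (bhP (n + 1)) ^ (n : ℝ)) ^ (((n : ℝ) + 1) / (2 * n + 1)) := by
  rw [bhConstR]
  rw [dif_neg (by omega), dif_neg (by omega), dif_neg (by omega), dif_neg (by omega)]
  have e : (2 * n + 1 - 1) / 2 = n := by omega
  have e' : (2 * n + 1 + 1) / 2 = n + 1 := by omega
  have e2 : (2 * ((2 * n + 1 : ℕ) : ℝ) - 2) / (((2 * n + 1 : ℕ) : ℝ) + 1) = bhP n := by
    unfold bhP; push_cast
    rw [div_eq_div_iff (by positivity) (by positivity)]; ring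
  have e3 : (2 * ((2 * n + 1 : ℕ) : ℝ) + 2) / (((2 * n + 1 : ℕ) : ℝ) + 3) = bhP (n + 1) := by
    unfold bhP; push_cast
    rw [div_eq_div_iff (by positivity) (by positivity)]; ring
  have e4 : (((2 * n + 1 : ℕ) : ℝ) + 1) / 2 = n + 1 := by push_cast; ring
  have e5 : (((2 * n + 1 : ℕ) : ℝ) - 1) / 2 = n := by push_cast; ring
  have e6 : (((2 * n + 1 : ℕ) : ℝ) - 1) / (2 * ((2 * n + 1 : ℕ) : ℝ)) = n / (2 * n + 1) := by
    push_cast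
    rw [div_eq_div_iff (by positivity) (by positivity)]; ring
  have e7 : (((2 * n + 1 : ℕ) : ℝ) + 1) / (2 * ((2 * n + 1 : ℕ) : ℝ)) = (n + 1) / (2 * n + 1) := by
    push_cast
    rw [div_eq_div_iff (by positivity) (by positivity)]; ring
  rw [e, e', e2, e3, e4, e5, e6, e7]

lemma khA_two : khinchineA 2 = 1 := by
  unfold khinchineA
  have h : Real.Gamma ((2 + 1) / 2) = 1 / 2 * Real.sqrt π := by
    rw [show ((2 : ℝ) + 1) / 2 = 1 / 2 + 1 by norm_num, Real.Gamma_add_one (by norm_num),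
      Real.Gamma_one_half_eq]
  have h2 : Real.sqrt π ≠ 0 := (Real.sqrt_pos.2 Real.pi_pos).ne'
  rw [h, mul_div_cancel_right₀ _ h2, ← Real.sqrt_eq_rpow, ← Real.sqrt_mul (by norm_num)]
  norm_num

lemma khA_diff : DifferentiableAt ℝ (fun p => Real.log (khinchineA p)) 2 := by
  have hpos := khA_pos (p := 2) (by norm_num)
  refine DifferentiableAt.log ?_ hpos.ne'
  unfold khinchineA
  have hG : DifferentiableAt ℝ (fun p : ℝ => Real.Gamma ((p + 1) / 2)) 2 := by
    refine DifferentiableAt.comp (g := Real.Gamma) (f := fun p : ℝ => (p + 1) / 2) 2 ?_ (by fun_prop)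
    apply Real.differentiableAt_Gamma
    intro m
    have : (0 : ℝ) ≤ m := by positivity
    intro h
    norm_num at h
    linarith
  have hg : 0 < Real.Gamma (((2 : ℝ) + 1) / 2) := Real.Gamma_pos_of_pos (by norm_num)
  have h2 : 0 < Real.sqrt π := Real.sqrt_pos.2 Real.pi_pos
  refine DifferentiableAt.const_mul ?_ _
  refine DifferentiableAt.rpow (hG.div_const _) ?_ (by positivity)
  exact (differentiableAt_const _).div differentiableAt_id (by norm_num)

lemma bhB_tendsto : ∃ c, Tendsto bhB atTop (nhds c) := by
  obtain ⟨d, hd⟩ : ∃ d, HasDerivAt (fun p => Real.log (khinchineA p)) d 2 :=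
    ⟨_, khA_diff.hasDerivAt⟩
  have hs := hasDerivAt_iff_tendsto_slope.1 hd
  have h0 : Tendsto (fun n : ℕ => 1 / ((n : ℝ) + 1)) atTop (nhds 0) :=
    tendsto_one_div_add_atTop_nhds_zero_nat
  have hPe : ∀ n : ℕ, bhP n = 2 - 2 * (1 / ((n : ℝ) + 1)) := by
    intro n; unfold bhP; field_simp; ring
  have hP : Tendsto bhP atTop (nhdsWithin 2 {2}ᶜ) := by
    refine tendsto_nhdsWithin_iff.2 ⟨?_, Eventually.of_forall fun n => ?_⟩
    · have := (h0.const_mul 2).const_sub 2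
      simp only [mul_zero, sub_zero] at this
      exact this.congr fun n => (hPe n).symm
    · have : 0 < 1 / ((n : ℝ) + 1) := by positivity
      simp only [Set.mem_compl_iff, Set.mem_singleton_iff, hPe]
      linarith
  have h1 := hs.comp hP
  have h3 : Tendsto (fun n : ℕ => -2 * (1 - 1 / ((n : ℝ) + 1))) atTop (nhds (-2 * (1 - 0))) :=
    (h0.const_sub 1).const_mul (-2)
  refine ⟨_, (h1.mul h3).congr fun n => ?_⟩
  simp only [Function.comp, slope_def_field, khA_two, Real.log_one, sub_zero, bhB]
  rw [hPe n]
  have : (n : ℝ) + 1 ≠ 0 := by positivity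
  generalize Real.log _ = x
  rw [show (2 - 2 * (1 / ((n : ℝ) + 1)) - 2) = -2 / ((n : ℝ) + 1) by ring]
  field_simp
  ring

/-- `(C_{2n+1}/C_{2n}) / (C_{n+1}/C_n)^((n+1)/(2n+1))` converges to `1`. -/
theorem bhConstR_odd_even_ratio :
    Tendsto
      (fun n : ℕ =>
        (bhConstR (2 * n + 1) / bhConstR (2 * n)) /
          (bhConstR (n + 1) / bhConstR n) ^ (((n : ℝ) + 1) / (2 * (n : ℝ) + 1)))
      atTop (nhds 1) := by
  obtain ⟨c, hc⟩ := bhB_tendsto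
  have hd : Tendsto (fun n => bhB n - bhB (n + 1)) atTop (nhds 0) := by
    have := hc.sub (hc.comp (tendsto_add_atTop_nat 1))
    simpa using this
  have hz : Tendsto (fun n : ℕ => ((n : ℝ) / (2 * n + 1)) * (bhB n - bhB (n + 1)))
      atTop (nhds 0) := by
    refine squeeze_zero_norm (fun n => ?_) (tendsto_norm_zero.comp hd)
    simp only [Function.comp]
    rw [norm_mul]
    refine mul_le_of_le_one_left (norm_nonneg _) ?_
    have hn : (0 : ℝ) ≤ n := by positivity
    rw [Real.norm_of_nonneg (by positivity), div_le_one (by positivity)]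
    linarith
  have he := (Real.continuous_exp.tendsto 0).comp hz
  rw [Real.exp_zero] at he
  refine he.congr' ?_
  filter_upwards [eventually_ge_atTop 2] with n hn
  have c0 := bh_pos n
  have c1 := bh_pos (n + 1)
  have c2 := bh_pos (2 * n)
  have c3 := bh_pos (2 * n + 1)
  have hn' : (2 : ℝ) ≤ n := by exact_mod_cast hn
  have a0 : 0 < khinchineA (bhP n) := khA_pos (by unfold bhP; positivity)
  have a1 : 0 < khinchineA (bhP (n + 1)) := khA_pos (by unfold bhP; positivity)
  simp only [Function.comp]
  rw [← Real.exp_log (show 0 < (bhConstR (2 * n + 1) / bhConstR (2 * n)) /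
          (bhConstR (n + 1) / bhConstR n) ^ (((n : ℝ) + 1) / (2 * (n : ℝ) + 1)) by positivity)]
  congr 1
  rw [bh_even n hn, bh_odd n hn]
  rw [Real.log_div (by positivity) (by positivity), Real.log_div (by positivity) (by positivity),
    Real.log_mul (by positivity) (by positivity), Real.log_rpow (by positivity),
    Real.log_rpow (by positivity), Real.log_rpow (by positivity),
    Real.log_div (by positivity) (by positivity), Real.log_div (by positivity) (by positivity),
    Real.log_div (by positivity) (by positivity), Real.log_rpow (by positivity),
    Real.log_rpow (by positivity), Real.log_div (by positivity) (by positivity),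
    Real.log_rpow (by positivity)]
  unfold bhB
  push_cast
  field_simp
  ring
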